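/- Let X be a compact Hausdorff space, A a semisimple commutative unital Banach algebra, and 𝑨 an admissible Banach A-valued function algebra on X with 𝔄 = 𝑨 ∩ C(X). If 𝑨 admits bounded relative units, then both 𝔄 and A admit bounded relative units. -/

import Mathlib

open WeakDual Topology

namespace VV

variable (B : Type*) [NormedCommRing B] [NormedAlgebra ℂ B]

/-- The ideal `I_ψ = {b | ψ b = 0}`. -/
def Iid (ψ : characterSpace ℂ B) : Set B := {b : B | ψ b = 0}

/-- The ideal `J_ψ` of elements whose Gelfand transform vanishes on a
neighbourhood of `ψ`. -/
def Jid (ψ : characterSpace ℂ B) : Set B :=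
  {b : B | ∃ U ∈ nhds ψ, ∀ χ ∈ U, χ b = 0}

/-- Regularity of a commutative Banach algebra. -/
def IsRegular : Prop :=
  ∀ E : Set (characterSpace ℂ B), IsClosed E →
    ∀ ψ₀ ∉ E, ∃ b : B, ψ₀ b ≠ 0 ∧ ∀ ψ ∈ E, ψ b = 0

def IsStronglyRegularAt (ψ : characterSpace ℂ B) : Prop :=
  Iid B ψ ⊆ closure (Jid B ψ)

def IsStronglyRegular : Prop := ∀ ψ : characterSpace ℂ B, IsStronglyRegularAt B ψ

/-- Bounded relative units at a character. -/
def HasBRUAt (ψ : characterSpace ℂ B) : Prop :=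
  ∃ M : ℝ, 0 < M ∧ ∀ K : Set (characterSpace ℂ B), IsCompact K → ψ ∉ K →
    ∃ b ∈ Jid B ψ, (∀ χ ∈ K, χ b = 1) ∧ ‖b‖ ≤ M

def HasBRU : Prop := ∀ ψ : characterSpace ℂ B, HasBRUAt B ψ

/-- Ditkin's condition at a character: `b ∈ closure (b • J_ψ)` for every `b ∈ I_ψ`. -/
def DitkinAt (ψ : characterSpace ℂ B) : Prop :=
  ∀ b ∈ Iid B ψ, b ∈ closure ((fun u => b * u) '' Jid B ψ)

def IsDitkin : Prop := ∀ ψ : characterSpace ℂ B, DitkinAt B ψ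

/-- `I` has a bounded approximate identity contained in `J`: a bounded net `(u_i)`
in `J` with `‖b * u_i - b‖ → 0` for every `b ∈ I`. -/
def HasBAI (I J : Set B) : Prop :=
  ∃ (ι : Type) (le : ι → ι → Prop) (u : ι → B) (M : ℝ),
    Nonempty ι ∧ (∀ i j : ι, ∃ k, le i k ∧ le j k) ∧
    (∀ i, u i ∈ J) ∧ (∀ i, ‖u i‖ ≤ M) ∧
    ∀ b ∈ I, ∀ ε : ℝ, 0 < ε → ∃ i, ∀ j, le i j → ‖b * u j - b‖ < ε

/-- Strong Ditkin's condition at `ψ`. -/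
def StrongDitkinAt (ψ : characterSpace ℂ B) : Prop := HasBAI B (Iid B ψ) (Jid B ψ)

def IsStrongDitkin : Prop := ∀ ψ : characterSpace ℂ B, StrongDitkinAt B ψ

/-- Normality. -/
def IsNormal : Prop :=
  ∀ E : Set (characterSpace ℂ B), IsClosed E → E ≠ Set.univ →
    ∀ F : Set (characterSpace ℂ B), IsCompact F → (∀ ψ ∈ F, ψ ∉ E) →
      ∃ b : B, (∀ ψ ∈ F, ψ b = 1) ∧ ∀ ψ ∈ E, ψ b = 0

/-- Semisimplicity: the Gelfand transform is injective. -/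
def IsSemisimple : Prop :=
  ∀ b : B, (∀ ψ : characterSpace ℂ B, ψ b = 0) → b = 0



variable (X : Type*) [TopologicalSpace X] [CompactSpace X] [T2Space X]
variable (A : Type*) [NormedCommRing A] [NormedAlgebra ℂ A] [CompleteSpace A] [Nontrivial A]

section FunctionAlgebra

variable (B : Type*) [NormedCommRing B] [NormedAlgebra ℂ B] [CompleteSpace B] [Nontrivial B]

/-- `𝑨` contains the constant functions. -/
def ContainsConstants (ι : B →ₐ[ℂ] C(X, A)) : Prop :=
  ∀ a : A, ∃ b : B, ∀ x : X, ι b x = a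

/-- `𝑨` separates the points of `X`. -/
def Separates (ι : B →ₐ[ℂ] C(X, A)) : Prop :=
  ∀ x y : X, x ≠ y → ∃ b : B, ι b x ≠ ι b y

/-- Admissibility: `φ ∘ f ∈ 𝑨` whenever `f ∈ 𝑨` and `φ ∈ Φ(A)`. -/
def Admissible (ι : B →ₐ[ℂ] C(X, A)) : Prop :=
  ∀ (f : B) (φ : characterSpace ℂ A), ∃ g : B,
    ∀ x : X, ι g x = algebraMap ℂ A (φ (ι f x))

/-- The subalgebra `𝔄 = 𝑨 ∩ C(X)` of scalar-valued members of `𝑨`. -/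
def scalarSub (ι : B →ₐ[ℂ] C(X, A)) : Subalgebra ℂ B where
  carrier := {b : B | ∀ x : X, ∃ c : ℂ, ι b x = algebraMap ℂ A c}
  mul_mem' := by
    intro b b' hb hb' x
    obtain ⟨c, hc⟩ := hb x
    obtain ⟨c', hc'⟩ := hb' x
    refine ⟨c * c', ?_⟩
    rw [map_mul, ContinuousMap.mul_apply, hc, hc', map_mul]
  add_mem' := by
    intro b b' hb hb' x
    obtain ⟨c, hc⟩ := hb x
    obtain ⟨c', hc'⟩ := hb' x
    refine ⟨c + c', ?_⟩
    rw [map_add, ContinuousMap.add_apply, hc, hc', map_add]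
  algebraMap_mem' := by
    intro r x
    refine ⟨r, ?_⟩
    rw [AlgHom.commutes]
    simp [Algebra.algebraMap_eq_smul_one]

/-- `𝑨` is an `A`-valued uniform algebra: its norm is equivalent to the sup norm. -/
def IsUniform (ι : B →ₐ[ℂ] C(X, A)) : Prop :=
  ∃ c C : ℝ, 0 < c ∧ ∀ b : B, c * ‖ι b‖ ≤ ‖b‖ ∧ ‖b‖ ≤ C * ‖ι b‖

/-- Every character of `𝑨` is of the form `ψ ⋄ φ`. -/
def NaturalProduct (ι : B →ₐ[ℂ] C(X, A)) : Prop :=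
  ∀ τ : characterSpace ℂ B,
    ∃ (ψ : characterSpace ℂ (scalarSub X A B ι)) (φ : characterSpace ℂ A),
      ∀ (f : B) (g : scalarSub X A B ι),
        (∀ x : X, ι (g : B) x = algebraMap ℂ A (φ (ι f x))) → τ f = ψ g

end FunctionAlgebra

end VV

namespace VV

/-- The pullback of a character along a continuous algebra homomorphism. -/
noncomputable def pullback {B C : Type*} [NormedCommRing B] [NormedAlgebra ℂ B]
    [NormedCommRing C] [NormedAlgebra ℂ C] (S : B →ₐ[ℂ] C) (hS : Continuous S)
    (χ : characterSpace ℂ C) : characterSpace ℂ B :=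
  ⟨StrongDual.toWeakDual ((CharacterSpace.toCLM χ).comp ⟨S.toLinearMap, hS⟩), by
    rw [CharacterSpace.eq_set_map_one_map_mul]
    refine ⟨?_, fun x y => ?_⟩
    · change χ (S 1) = 1
      rw [map_one, map_one]
    · change χ (S (x * y)) = χ (S x) * χ (S y)
      rw [map_mul, map_mul]⟩

section Pullback

variable {B C : Type*} [NormedCommRing B] [NormedAlgebra ℂ B]
  [NormedCommRing C] [NormedAlgebra ℂ C]

theorem pullback_apply (S : B →ₐ[ℂ] C) (hS : Continuous S) (χ : characterSpace ℂ C) (b : B) :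
    pullback S hS χ b = χ (S b) := rfl

theorem continuous_pullback (S : B →ₐ[ℂ] C) (hS : Continuous S) :
    Continuous (pullback S hS) :=
  Continuous.subtype_mk (WeakDual.continuous_of_continuous_eval fun b =>
    (WeakDual.eval_continuous (S b)).comp continuous_subtype_val) _

theorem pullback_injective (S : B →ₐ[ℂ] C) (hS : Continuous S) (hsurj : Function.Surjective S) :
    Function.Injective (pullback S hS) := by
  intro χ χ' h
  refine CharacterSpace.ext fun c => ?_
  obtain ⟨b, rfl⟩ := hsurj c
  exact DFunLike.congr_fun h b

theorem HasBRU.of_surjective (hB : HasBRU B) (S : B →ₐ[ℂ] C) (hS : Continuous S)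
    (hsurj : Function.Surjective S) : HasBRU C := by
  intro ψ
  obtain ⟨M, hM, h⟩ := hB (pullback S hS ψ)
  let L : B →L[ℂ] C := ⟨S.toLinearMap, hS⟩
  refine ⟨(‖L‖ + 1) * M, by positivity, fun K hK hψ => ?_⟩
  obtain ⟨b, ⟨U, hU, hbU⟩, hbK, hbM⟩ := h (pullback S hS '' K)
    (hK.image (continuous_pullback S hS))
    (fun ⟨χ, hχ, heq⟩ => hψ (pullback_injective S hS hsurj heq ▸ hχ))
  refine ⟨S b, ⟨pullback S hS ⁻¹' U, (continuous_pullback S hS).continuousAt hU,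
    fun χ hχ => hbU _ hχ⟩, fun χ hχ => hbK _ (Set.mem_image_of_mem _ hχ), ?_⟩
  calc ‖S b‖ ≤ ‖L‖ * ‖b‖ := L.le_opNorm b
    _ ≤ (‖L‖ + 1) * M := by gcongr; linarith

/-- Homomorphisms into semisimple commutative Banach algebras are continuous. -/
theorem IsSemisimple.continuous_algHom [CompleteSpace B] [CompleteSpace C]
    (hC : IsSemisimple C) (S : B →ₐ[ℂ] C) : Continuous S := by
  refine S.toLinearMap.continuous_of_seq_closed_graph fun u b c hu hSu => ?_
  refine sub_eq_zero.mp (hC _ fun χ => ?_)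
  rw [map_sub, sub_eq_zero]
  let τ : B →ₐ[ℂ] ℂ := (CharacterSpace.toAlgHom χ).comp S
  have hτ : Continuous τ := map_continuous τ
  exact tendsto_nhds_unique (((map_continuous χ).tendsto c).comp hSu) ((hτ.tendsto b).comp hu)

end Pullback

section FunctionAlgebra

variable {X : Type*} [TopologicalSpace X]
  {A : Type*} [NormedCommRing A] [NormedAlgebra ℂ A]
  {B : Type*} [NormedCommRing B] [NormedAlgebra ℂ B] [CompleteSpace B]
  {ι : B →ₐ[ℂ] C(X, A)}

theorem IsSemisimple.of_injective [CompleteSpace A] (hss : IsSemisimple A) (hinj : Function.Injective ι) :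
    IsSemisimple B := by
  intro b hb
  refine hinj (ContinuousMap.ext fun x => ?_)
  rw [map_zero, ContinuousMap.zero_apply]
  let S : B →ₐ[ℂ] A := (ContinuousMap.evalAlgHom ℂ A x).comp ι
  exact hss _ fun χ => hb (pullback S (hss.continuous_algHom S) χ)

theorem exists_continuous_surjective_scalarSub (hinj : Function.Injective ι)
    (hadm : Admissible X A B ι) (hB : IsSemisimple B) (φ : characterSpace ℂ A) :
    ∃ T : B →ₐ[ℂ] scalarSub X A B ι, Continuous T ∧ Function.Surjective T := by
  choose g hg using fun f => hadm f φ
  have eq_g {b f : B} (h : ∀ x, ι b x = algebraMap ℂ A (φ (ι f x))) : g f = b :=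
    hinj (ContinuousMap.ext fun x => (hg f x).trans (h x).symm)
  let T₀ : B →ₐ[ℂ] B :=
    { toFun := g
      map_one' := eq_g fun x => by simp
      map_mul' := fun b c => eq_g fun x => by simp [hg]
      map_zero' := eq_g fun x => by simp
      map_add' := fun b c => eq_g fun x => by simp [hg]
      commutes' := fun r => eq_g fun x => by
        simp [Algebra.algebraMap_eq_smul_one] }
  refine ⟨T₀.codRestrict _ fun f x => ⟨_, hg f x⟩,
    (hB.continuous_algHom T₀).subtype_mk _, fun ⟨b, hb⟩ => ⟨b, Subtype.ext (eq_g fun x => ?_)⟩⟩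
  obtain ⟨c, hc⟩ := hb x
  rw [hc, AlgHomClass.commutes, Algebra.algebraMap_self_apply]

end FunctionAlgebra

end VV

theorem bru_inherited
    (X : Type*) [TopologicalSpace X] [CompactSpace X] [T2Space X]
    (A : Type*) [NormedCommRing A] [NormedAlgebra ℂ A] [CompleteSpace A] [Nontrivial A]
    (hss : VV.IsSemisimple A)
    (B : Type*) [NormedCommRing B] [NormedAlgebra ℂ B] [CompleteSpace B] [Nontrivial B]
    (ι : B →ₐ[ℂ] C(X, A)) (hinj : Function.Injective ι)
    (hconst : VV.ContainsConstants X A B ι) (hsep : VV.Separates X A B ι)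
    (hadm : VV.Admissible X A B ι)
    (hB : VV.HasBRU B) :
    VV.HasBRU (VV.scalarSub X A B ι) ∧ VV.HasBRU A := by
  have hss_B := hss.of_injective hinj
  have : Nonempty X := by
    by_contra h
    rw [not_nonempty_iff] at h
    exact one_ne_zero (hinj (ContinuousMap.ext fun x => h.elim x) : (1 : B) = 0)
  obtain ⟨x⟩ := this
  obtain ⟨φ⟩ : Nonempty (characterSpace ℂ A) := inferInstance
  obtain ⟨T, hT_cont, hT_surj⟩ := VV.exists_continuous_surjective_scalarSub hinj hadm hss_B φ
  refine ⟨hB.of_surjective T hT_cont hT_surj, ?_⟩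
  let S : B →ₐ[ℂ] A := (ContinuousMap.evalAlgHom ℂ A x).comp ι
  refine hB.of_surjective S (hss.continuous_algHom S) fun a => ?_
  obtain ⟨b, hb⟩ := hconst a
  exact ⟨b, hb x⟩
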